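/- In the Bellman setup with the uniformly-bounded-potential assumption, every fixed point x of the Bellman operator F dominates the value of every selector: for every selector σ, the series Σ_{i=0}^∞ A_σ^i *ᵥ b_σ converges absolutely and Σ_{i=0}^∞ A_σ^i *ᵥ b_σ ≤ x coordinatewise. -/

import Mathlib

open Matrix

/-- Powers of an entrywise nonnegative matrix are entrywise nonnegative. -/
theorem Matrix.pow_apply_nonneg_of_nonneg {Q : Type*} [Fintype Q] [DecidableEq Q]
    {A : Matrix Q Q ℝ} (hA : ∀ p q, 0 ≤ A p q) (n : ℕ) (p q : Q) : 0 ≤ (A ^ n) p q := by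
  induction n generalizing p q with
  | zero => rw [pow_zero, Matrix.one_apply]; split_ifs <;> norm_num
  | succ n ih =>
    rw [pow_succ, Matrix.mul_apply]
    exact Finset.sum_nonneg fun k _ => mul_nonneg (ih p k) (hA k q)

/-- A nonnegative matrix whose potential applied to the all-ones vector has bounded partial sums
has an absolutely convergent potential on every vector. -/
theorem Matrix.summable_abs_pow_mulVec {Q : Type*} [Fintype Q] [DecidableEq Q]
    {A : Matrix Q Q ℝ} (hA : ∀ p q, 0 ≤ A p q) {K : ℝ}
    (hK : ∀ (k : ℕ) (q : Q),
      ((∑ i ∈ Finset.range (k + 1), A ^ i) *ᵥ (fun _ => (1 : ℝ))) q ≤ K)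
    (v : Q → ℝ) (q : Q) : Summable fun i : ℕ => |(A ^ i *ᵥ v) q| := by
  have hpow := Matrix.pow_apply_nonneg_of_nonneg hA
  have hnonneg (i : ℕ) : 0 ≤ (A ^ i *ᵥ fun _ => (1 : ℝ)) q :=
    Finset.sum_nonneg fun p _ => mul_nonneg (hpow i q p) zero_le_one
  have hones : Summable fun i : ℕ => (A ^ i *ᵥ fun _ => (1 : ℝ)) q := by
    refine summable_of_sum_range_le (c := K) hnonneg fun n => ?_
    have h := hK n q
    rw [Matrix.sum_mulVec, Finset.sum_apply, Finset.sum_range_succ] at h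
    linarith [hnonneg n]
  refine Summable.of_nonneg_of_le (fun _ => abs_nonneg _) (fun i => ?_)
    (hones.mul_left (∑ p, |v p|))
  simp only [Matrix.mulVec, dotProduct, Finset.mul_sum, mul_one]
  refine (Finset.abs_sum_le_sum_abs _ _).trans (Finset.sum_le_sum fun p _ => ?_)
  rw [abs_mul, abs_of_nonneg (hpow i q p), mul_comm]
  exact mul_le_mul_of_nonneg_right
    (Finset.single_le_sum (f := fun p => |v p|) (fun _ _ => abs_nonneg _) (Finset.mem_univ p))
    (hpow i q p)

/-- Iterating `b + A x ≤ x` for a nonnegative matrix `A`. -/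
theorem Matrix.sum_pow_mulVec_add_le {Q : Type*} [Fintype Q] [DecidableEq Q]
    {A : Matrix Q Q ℝ} (hA : ∀ p q, 0 ≤ A p q) {b x : Q → ℝ}
    (h : ∀ q, b q + (A *ᵥ x) q ≤ x q) (n : ℕ) (q : Q) :
    ∑ i ∈ Finset.range n, (A ^ i *ᵥ b) q + (A ^ n *ᵥ x) q ≤ x q := by
  induction n with
  | zero => simp
  | succ n ih =>
    have hstep : (A ^ n *ᵥ (b + A *ᵥ x)) q ≤ (A ^ n *ᵥ x) q :=
      Finset.sum_le_sum fun p _ =>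
        mul_le_mul_of_nonneg_left (h p) (Matrix.pow_apply_nonneg_of_nonneg hA n q p)
    rw [Matrix.mulVec_add, Matrix.mulVec_mulVec, ← pow_succ, Pi.add_apply] at hstep
    rw [Finset.sum_range_succ]
    linarith

/-- Bellman setup: under the uniformly bounded potential assumption, every
fixed point `x` of the Bellman operator `F` dominates the value of every selector `σ`:
the series `Σ_{i=0}^∞ A_σ^i *ᵥ b_σ` converges absolutely (coordinatewise) and is `≤ x`
coordinatewise, where `A_σ q q' = w q (σ q) q'` and `b_σ q = r q (σ q)`. -/
theorem stmt11 {Q : Type*} [Fintype Q] [DecidableEq Q] {α : Type*}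
    (act : Q → Finset α) (hact : ∀ q, (act q).Nonempty)
    (r : Q → α → ℝ) (w : Q → α → Q → ℝ)
    (hw : ∀ q a, a ∈ act q → ∀ q', 0 ≤ w q a q')
    (K : ℝ)
    (hK : ∀ σ : Q → α, (∀ q, σ q ∈ act q) → ∀ (k : ℕ) (j : Q),
      ((∑ i ∈ Finset.range (k + 1), (Matrix.of fun q q' => w q (σ q) q') ^ i)
        *ᵥ (fun _ => (1 : ℝ))) j ≤ K)
    (F : (Q → ℝ) → (Q → ℝ))
    (hF : ∀ x q, F x q = (act q).sup' (hact q)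
      (fun a => r q a + ∑ q', w q a q' * x q'))
    (x : Q → ℝ) (hx : F x = x) :
    ∀ σ : Q → α, (∀ q, σ q ∈ act q) →
      (∀ q, Summable (fun i : ℕ =>
        |(((Matrix.of fun q q' => w q (σ q) q') ^ i) *ᵥ (fun q => r q (σ q))) q|)) ∧
      (∀ q, (∑' i : ℕ,
        (((Matrix.of fun q q' => w q (σ q) q') ^ i) *ᵥ (fun q => r q (σ q))) q) ≤ x q) := by
  intro σ hσ
  have hA (p q : Q) : 0 ≤ (Matrix.of fun q q' => w q (σ q) q') p q := hw p (σ p) (hσ p) q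
  have hsum := Matrix.summable_abs_pow_mulVec hA (hK σ hσ)
  have hsub (q : Q) :
      r q (σ q) + ((Matrix.of fun q q' => w q (σ q) q') *ᵥ x) q ≤ x q := by
    have h := Finset.le_sup' (fun a => r q a + ∑ q', w q a q' * x q') (hσ q)
    rw [← hF, hx] at h
    exact h
  refine ⟨hsum _, fun q => ?_⟩
  have hlim := (hsum (fun q => r q (σ q)) q).of_abs.hasSum.tendsto_sum_nat.add
    (hsum x q).of_abs.tendsto_atTop_zero
  rw [add_zero] at hlim
  exact le_of_tendsto' hlim fun n => Matrix.sum_pow_mulVec_add_le hA hsub n q
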